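/- Let μ₁ be an unramified quasi-character of Fˣ and μ₂ a quasi-character of Fˣ of level c ≥ 1. For α ∈ Fˣ define the shell sum S(α) = Σ_{l ≤ v(α)−c} ∫_{v(m)=l} μ₁⁻¹(α/m)·μ₂⁻¹(−m)·|α|^{1/2}·|m|⁻¹·ψ(m) dm (all but at most one shell term vanish, namely only l = −c can contribute). Set C = q^{−c}·μ₁(ϖ)^{−c}·∫_{v(m)=−c} μ₂⁻¹(−m)·ψ(m) dm. Then C ≠ 0, and S(α) = C·q^{−v(α)/2}·μ₁(ϖ)^{−v(α)} if v(α) ≥ 0, while S(α) = 0 if v(α) < 0. (S(α) is the value W(diag(α,1)) of the Whittaker function, with respect to ψ⁻, of the new vector of the ramified principal series π(μ₁⁻¹,μ₂⁻¹) of level c.) -/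

import Mathlib

open MeasureTheory

namespace Stmt19

/-- The ball of radius index `n`. -/
def Bl {F : Type*} [Field F] (v : F → ℤ) (n : ℤ) (x : F) : Prop := x = 0 ∨ n ≤ v x

/-- Valuation axioms. -/
structure Val {F : Type*} [Field F] (v : F → ℤ) : Prop where
  mul : ∀ x y : F, x ≠ 0 → y ≠ 0 → v (x * y) = v x + v y
  add : ∀ x y : F, x ≠ 0 → y ≠ 0 → x + y ≠ 0 → min (v x) (v y) ≤ v (x + y)

section val
variable {F : Type*} [Field F] {v : F → ℤ}

theorem Val.one (h : Val v) : v 1 = 0 := by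
  have := h.mul 1 1 one_ne_zero one_ne_zero
  rw [mul_one] at this; omega

theorem Val.neg_one (h : Val v) : v (-1) = 0 := by
  have := h.mul (-1) (-1) (neg_ne_zero.2 one_ne_zero) (neg_ne_zero.2 one_ne_zero)
  rw [neg_mul_neg, mul_one, h.one] at this; omega

theorem Val.neg (h : Val v) (x : F) : v (-x) = v x := by
  by_cases hx : x = 0
  · simp [hx]
  · have := h.mul (-1) x (neg_ne_zero.2 one_ne_zero) hx
    rw [h.neg_one, neg_one_mul] at this; omega

theorem Val.inv (h : Val v) (x : F) (hx : x ≠ 0) : v x⁻¹ = - v x := by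
  have := h.mul x x⁻¹ hx (inv_ne_zero hx)
  rw [mul_inv_cancel₀ hx, h.one] at this; omega

theorem Val.div (h : Val v) (x y : F) (hx : x ≠ 0) (hy : y ≠ 0) : v (x / y) = v x - v y := by
  rw [div_eq_mul_inv, h.mul x _ hx (inv_ne_zero hy), h.inv y hy]; ring

theorem Val.zpow (h : Val v) (x : F) (hx : x ≠ 0) (n : ℤ) : v (x ^ n) = n * v x := by
  induction n using Int.induction_on with
  | zero => simp [h.one]
  | succ n ih => rw [zpow_add_one₀ hx, h.mul _ _ (zpow_ne_zero _ hx) hx, ih]; ring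
  | pred n ih =>
    rw [zpow_sub_one₀ hx, h.mul _ _ (zpow_ne_zero _ hx) (inv_ne_zero hx), ih, h.inv x hx]; ring

theorem Bl.neg (h : Val v) {n : ℤ} {x : F} (hx : Bl v n x) : Bl v n (-x) := by
  rcases hx with hx | hx
  · left; simp [hx]
  · right; rwa [h.neg]

theorem Bl.mono {n k : ℤ} {x : F} (hx : Bl v n x) (hk : k ≤ n) : Bl v k x := by
  rcases hx with hx | hx
  · exact Or.inl hx
  · exact Or.inr (hk.trans hx)

theorem Bl.add (h : Val v) {n : ℤ} {x y : F} (hx : Bl v n x) (hy : Bl v n y) :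
    Bl v n (x + y) := by
  by_cases hx0 : x = 0
  · simpa [hx0] using hy
  by_cases hy0 : y = 0
  · simpa [hy0] using hx
  by_cases hxy : x + y = 0
  · exact Or.inl hxy
  have h1 := hx.resolve_left hx0
  have h2 := hy.resolve_left hy0
  exact Or.inr ((le_min h1 h2).trans (h.add x y hx0 hy0 hxy))

theorem Bl.sub (h : Val v) {n : ℤ} {x y : F} (hx : Bl v n x) (hy : Bl v n y) :
    Bl v n (x - y) := by
  rw [sub_eq_add_neg]; exact hx.add h (hy.neg h)

theorem Bl.mul (h : Val v) {n k : ℤ} {x y : F} (hx : Bl v n x) (hy : Bl v k y) :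
    Bl v (n + k) (x * y) := by
  by_cases hx0 : x = 0
  · left; simp [hx0]
  by_cases hy0 : y = 0
  · left; simp [hy0]
  right
  rw [h.mul x y hx0 hy0]
  exact add_le_add (hx.resolve_left hx0) (hy.resolve_left hy0)

/-- The shell of valuation `l`. -/
def Sh (v : F → ℤ) (l : ℤ) (x : F) : Prop := x ≠ 0 ∧ v x = l

theorem Sh.bl {l : ℤ} {x : F} (hx : Sh v l x) : Bl v l x := Or.inr hx.2.ge

theorem Sh.not_bl {l n : ℤ} {x : F} (hx : Sh v l x) (hn : l < n) : ¬ Bl v n x := by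
  rintro (h | h)
  · exact hx.1 h
  · have := hx.2; omega

theorem sh_iff {l : ℤ} {x : F} : Sh v l x ↔ Bl v l x ∧ ¬ Bl v (l + 1) x := by
  constructor
  · intro hx; exact ⟨hx.bl, hx.not_bl (by omega)⟩
  · rintro ⟨h1, h2⟩
    unfold Bl at h2; push Not at h2
    refine ⟨h2.1, ?_⟩
    have := h1.resolve_left h2.1
    omega

theorem Sh.add (h : Val v) {l n : ℤ} {x t : F} (hx : Sh v l x) (hn : l < n) (ht : Bl v n t) :
    Sh v l (x + t) := by
  rw [sh_iff] at *
  refine ⟨hx.1.add h (ht.mono hn.le), fun h2 => hx.2 ?_⟩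
  have := h2.sub h (ht.mono (k := l + 1) (by omega))
  simpa using this

theorem sh_add_iff (h : Val v) {l n : ℤ} {x t : F} (hn : l < n) (ht : Bl v n t) :
    Sh v l (x + t) ↔ Sh v l x := by
  constructor
  · intro hx
    have := hx.add h hn (ht.neg h)
    simpa using this
  · intro hx; exact hx.add h hn ht

theorem Sh.mul (h : Val v) {l k : ℤ} {x y : F} (hx : Sh v l x) (hy : Sh v k y) :
    Sh v (l + k) (x * y) := by
  refine ⟨mul_ne_zero hx.1 hy.1, ?_⟩
  rw [h.mul _ _ hx.1 hy.1, hx.2, hy.2]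

theorem Sh.inv (h : Val v) {l : ℤ} {x : F} (hx : Sh v l x) : Sh v (-l) x⁻¹ := by
  refine ⟨inv_ne_zero hx.1, ?_⟩
  rw [h.inv _ hx.1, hx.2]

theorem Sh.neg (h : Val v) {l : ℤ} {x : F} (hx : Sh v l x) : Sh v l (-x) := by
  refine ⟨neg_ne_zero.2 hx.1, ?_⟩
  rw [h.neg, hx.2]

theorem sh_mul_iff (h : Val v) {l : ℤ} {u x : F} (hu : Sh v 0 u) :
    Sh v l (u * x) ↔ Sh v l x := by
  constructor
  · intro hx
    have := (hu.inv h).mul h hx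
    rw [inv_mul_cancel_left₀ hu.1] at this
    simpa using this
  · intro hx; simpa using hu.mul h hx

theorem bl_mul_iff (h : Val v) {l : ℤ} {u x : F} (hu : Sh v 0 u) :
    Bl v l (u * x) ↔ Bl v l x := by
  constructor
  · intro hx
    have := (hu.inv h).bl.mul h hx
    rw [inv_mul_cancel_left₀ hu.1] at this
    simpa using this
  · intro hx; simpa using hu.bl.mul h hx

/-- `R` is a set of representatives of ball `M` modulo ball `N`. -/
structure IsRep (v : F → ℤ) (M N : ℤ) (R : Finset F) : Prop where
  mem : ∀ r ∈ R, Bl v M r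
  ex : ∀ m, Bl v M m → ∃ r ∈ R, Bl v N (m - r)
  uniq : ∀ r ∈ R, ∀ r' ∈ R, Bl v N (r - r') → r = r'

theorem bl_sub_comm (h : Val v) {n : ℤ} {x y : F} : Bl v n (x - y) ↔ Bl v n (y - x) := by
  constructor <;> intro hx <;> simpa using hx.neg h

open Classical in
theorem IsRep.expand (h : Val v) {M N : ℤ} {R : Finset F} (hR : IsRep v M N R)
    (f : F → ℂ) (hf : ∀ m t, Bl v N t → f (m + t) = f m) (m : F) (hm : Bl v M m) :
    f m = ∑ r ∈ R, if Bl v N (m - r) then f r else 0 := by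
  obtain ⟨r, hr, hmr⟩ := hR.ex m hm
  rw [Finset.sum_eq_single r]
  · rw [if_pos hmr, ← hf r (m - r) hmr]; simp
  · intro b hb hbr
    rw [if_neg]
    intro hmb
    apply hbr
    apply hR.uniq b hb r hr
    have := hmr.sub h hmb
    simpa using this
  · intro h; exact absurd hr h

theorem IsRep.sum_eq (h : Val v) {M N : ℤ} {R R' : Finset F} (hR : IsRep v M N R)
    (hR' : IsRep v M N R')
    (f : F → ℂ) (hf : ∀ m t, Bl v N t → f (m + t) = f m) :
    ∑ r ∈ R, f r = ∑ r ∈ R', f r := by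
  classical
  rw [Finset.sum_congr rfl (fun r hr => hR'.expand h f hf r (hR.mem r hr)), Finset.sum_comm]
  refine Finset.sum_congr rfl fun r hr => ?_
  refine Eq.trans ?_ (hR.expand h f hf r (hR'.mem r hr)).symm
  refine Finset.sum_congr rfl fun s hs => ?_
  by_cases hb : Bl v N (s - r)
  · rw [if_pos hb, if_pos ((bl_sub_comm h).1 hb), ← hf r (s - r) hb]; simp
  · rw [if_neg hb, if_neg (fun h' => hb ((bl_sub_comm h).1 h'))]

theorem IsRep.sum_shift (h : Val v) {M N : ℤ} {R : Finset F} (hR : IsRep v M N R)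
    (f : F → ℂ) (hf : ∀ m t, Bl v N t → f (m + t) = f m) (t : F) (ht : Bl v M t) :
    ∑ r ∈ R, f (r + t) = ∑ r ∈ R, f r := by
  classical
  have h2 : IsRep v M N (R.image (fun r => r + t)) := by
    refine ⟨?_, ?_, ?_⟩
    · intro r hr
      obtain ⟨s, hs, rfl⟩ := Finset.mem_image.1 hr
      exact (hR.mem s hs).add h ht
    · intro m hm
      obtain ⟨r, hr, hh⟩ := hR.ex (m - t) (hm.sub h ht)
      refine ⟨r + t, Finset.mem_image_of_mem _ hr, ?_⟩
      rwa [show m - (r + t) = m - t - r by ring]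
    · intro r hr r' hr' hh
      obtain ⟨s, hs, rfl⟩ := Finset.mem_image.1 hr
      obtain ⟨s', hs', rfl⟩ := Finset.mem_image.1 hr'
      rw [hR.uniq s hs s' hs' (by simpa using hh)]
  rw [hR.sum_eq h h2 f hf, Finset.sum_image]
  intro a _ b _ hab
  exact add_right_cancel hab

theorem IsRep.sum_mul (h : Val v) {M N : ℤ} {R : Finset F} (hR : IsRep v M N R)
    (f : F → ℂ) (hf : ∀ m t, Bl v N t → f (m + t) = f m) (u : F) (hu : Sh v 0 u) :
    ∑ r ∈ R, f (u * r) = ∑ r ∈ R, f r := by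
  classical
  have h2 : IsRep v M N (R.image (fun r => u * r)) := by
    refine ⟨?_, ?_, ?_⟩
    · intro r hr
      obtain ⟨s, hs, rfl⟩ := Finset.mem_image.1 hr
      exact (bl_mul_iff h hu).2 (hR.mem s hs)
    · intro m hm
      obtain ⟨r, hr, hh⟩ := hR.ex (u⁻¹ * m) (by
        rw [← bl_mul_iff h hu, mul_inv_cancel_left₀ hu.1]; exact hm)
      refine ⟨u * r, Finset.mem_image_of_mem _ hr, ?_⟩
      rw [← bl_mul_iff h hu, mul_sub, mul_inv_cancel_left₀ hu.1] at hh
      exact hh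
    · intro r hr r' hr' hh
      obtain ⟨s, hs, rfl⟩ := Finset.mem_image.1 hr
      obtain ⟨s', hs', rfl⟩ := Finset.mem_image.1 hr'
      rw [hR.uniq s hs s' hs' (by rw [← bl_mul_iff h hu, mul_sub]; exact hh)]
  rw [hR.sum_eq h h2 f hf, Finset.sum_image]
  intro a _ b _ hab
  exact mul_left_cancel₀ hu.1 hab

end val

section meas
variable {F : Type*} [Field F] {v : F → ℤ} [MeasurableSpace F]

theorem meas_ball (hms : ∀ n : ℤ, MeasurableSet {x : F | x ≠ 0 ∧ v x = n}) (n : ℤ) :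
    MeasurableSet {x : F | Bl v n x} := by
  have : {x : F | Bl v n x} = (⋃ k : {k : ℤ // k < n}, {x : F | x ≠ 0 ∧ v x = k})ᶜ := by
    ext x
    simp only [Bl, Set.mem_ofPred_eq, Set.mem_compl_iff, Set.mem_iUnion, not_exists, not_and,
      Subtype.forall]
    constructor
    · rintro (h | h) k hk hx
      · exact absurd h hx
      · omega
    · intro h
      by_cases hx : x = 0
      · exact Or.inl hx
      · right
        by_contra hlt
        exact h (v x) (by omega) hx rfl
  rw [this]
  exact (MeasurableSet.iUnion fun k : {k : ℤ // k < n} => hms k.1).compl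

theorem meas_coset (hms : ∀ n : ℤ, MeasurableSet {x : F | x ≠ 0 ∧ v x = n}) {μ : Measure F}
    (haar : ∀ a : F, MeasurePreserving (fun x => a + x) μ μ) (n : ℤ) (r : F) :
    MeasurableSet {x : F | Bl v n (x - r)} ∧
      μ {x : F | Bl v n (x - r)} = μ {x : F | Bl v n x} := by
  have : {x : F | Bl v n (x - r)} = (fun x => -r + x) ⁻¹' {x : F | Bl v n x} := by
    ext x; simp [sub_eq_neg_add]
  rw [this]
  exact ⟨(haar (-r)).measurable (meas_ball hms n),
    (haar (-r)).measure_preimage (meas_ball hms n).nullMeasurableSet⟩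

theorem exists_rep (h : Val v) (hms : ∀ n : ℤ, MeasurableSet {x : F | x ≠ 0 ∧ v x = n})
    {μ : Measure F} (haar : ∀ a : F, MeasurePreserving (fun x => a + x) μ μ)
    (M N : ℤ) (hMN : M ≤ N) (h0 : μ {x : F | Bl v N x} ≠ 0) (ht : μ {x : F | Bl v M x} ≠ ⊤) :
    ∃ R : Finset F, IsRep v M N R := by
  classical
  let s : Setoid F := ⟨fun x y => Bl v N (x - y), fun x => Or.inl (sub_self x),
    fun hx => (bl_sub_comm h).1 hx, fun {x y z} hx hy => by
      have := hx.add h hy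
      simpa using this⟩
  let T : Set F := {x | Bl v M x ∧ (Quotient.mk s x).out = x}
  have hout : ∀ x : F, Bl v N ((Quotient.mk s x).out - x) := fun x =>
    Quotient.mk_out (s := s) x
  have huniq : ∀ r ∈ T, ∀ r' ∈ T, Bl v N (r - r') → r = r' := by
    intro r hr r' hr' hh
    have : Quotient.mk s r = Quotient.mk s r' := Quotient.sound hh
    rw [← hr.2, ← hr'.2, this]
  have hfin : T.Finite := by
    have key := Measure.finite_const_le_meas_of_disjoint_iUnion μ
      (pos_iff_ne_zero.2 h0) (As := fun r : T => {x : F | Bl v N (x - r)})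
      (fun r => (meas_coset hms haar N r).1)
      (by
        intro r r' hrr
        rw [Function.onFun, Set.disjoint_left]
        intro x hx hx'
        apply hrr
        apply Subtype.ext
        apply huniq r r.2 r' r'.2
        have := Bl.sub h hx' hx
        simpa using this)
      (by
        refine ne_top_of_le_ne_top ht (measure_mono ?_)
        intro x hx
        obtain ⟨r, hr⟩ := Set.mem_iUnion.1 hx
        have := (Bl.mono hr hMN).add h r.2.1
        simpa using this)
    have huniv : {i : T | μ {x : F | Bl v N x} ≤ μ {x : F | Bl v N (x - i)}} = Set.univ := by
      ext i
      simp [(meas_coset hms haar N (i : F)).2]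
    rw [huniv] at key
    exact Set.finite_coe_iff.1 (Set.finite_univ_iff.1 key)
  refine ⟨hfin.toFinset, ?_, ?_, ?_⟩
  · intro r hr; exact (hfin.mem_toFinset.1 hr).1
  · intro m hm
    refine ⟨(Quotient.mk s m).out, hfin.mem_toFinset.2 ⟨?_, ?_⟩, (bl_sub_comm h).1 (hout m)⟩
    · have := ((hout m).mono hMN).add h hm
      simpa using this
    · rw [Quotient.out_eq]
  · intro r hr r' hr' hh
    exact huniq r (hfin.mem_toFinset.1 hr) r' (hfin.mem_toFinset.1 hr') hh

theorem integral_rep (h : Val v) (hms : ∀ n : ℤ, MeasurableSet {x : F | x ≠ 0 ∧ v x = n})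
    {μ : Measure F} (haar : ∀ a : F, MeasurePreserving (fun x => a + x) μ μ)
    (M N : ℤ) (hMN : M ≤ N) (ht : μ {x : F | Bl v N x} ≠ ⊤)
    {R : Finset F} (hR : IsRep v M N R) (f : F → ℂ)
    (hf : ∀ m t, Bl v N t → f (m + t) = f m) (hs : ∀ m, ¬ Bl v M m → f m = 0) :
    ∫ m, f m ∂μ = (μ.real {x : F | Bl v N x} : ℂ) * ∑ r ∈ R, f r := by
  classical
  have : f = fun m => ∑ r ∈ R, Set.indicator {x : F | Bl v N (x - r)} (fun _ => f r) m := by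
    funext m
    simp only [Set.indicator_apply, Set.mem_ofPred_eq]
    by_cases hm : Bl v M m
    · exact hR.expand h f hf m hm
    · rw [hs m hm, Finset.sum_eq_zero]
      intro r hr
      rw [if_neg]
      intro hh
      apply hm
      have := (hh.mono hMN).add h (hR.mem r hr)
      simpa using this
  rw [integral_congr_ae (Filter.Eventually.of_forall fun m => congrFun this m), integral_finsetSum]
  · rw [Finset.mul_sum]
    refine Finset.sum_congr rfl fun r hr => ?_
    rw [integral_indicator_const _ (meas_coset hms haar N r).1, measureReal_def,
      (meas_coset hms haar N r).2, ← measureReal_def, Complex.real_smul]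
  · intro r hr
    refine (integrable_indicator_iff (meas_coset hms haar N r).1).2 ?_
    refine integrableOn_const ?_
    rw [(meas_coset hms haar N r).2]; exact ht

end meas

section chars
variable {F : Type*} [Field F] {v : F → ℤ}

open Classical in
/-- The twisted integrand on the shell. -/
noncomputable def hh (v : F → ℤ) (ψ χ : F → ℂ) (l : ℤ) (a m : F) : ℂ :=
  if Sh v l m then (χ (-m))⁻¹ * ψ (a * m) else 0

theorem chi_add (h : Val v) {χ : F → ℂ}
    (hχm : ∀ x y : F, x ≠ 0 → y ≠ 0 → χ (x * y) = χ x * χ y)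
    {c : ℤ} (hc : 1 ≤ c) (htriv : ∀ x : F, Bl v c x → χ (1 + x) = 1)
    {l : ℤ} {m t : F} (hm : Sh v l m) (ht : Bl v (l + c) t) : χ (-(m + t)) = χ (-m) := by
  have hb : Bl v c (t / m) := by
    have := ht.mul h (hm.inv h).bl
    rw [div_eq_mul_inv]
    exact this.mono (by omega)
  have h1 : Sh v 0 (1 + t / m) :=
    Sh.add h (l := 0) (n := c) ⟨one_ne_zero, h.one⟩ (by omega) hb
  have : -(m + t) = -m * (1 + t / m) := by
    have := hm.1
    field_simp
  rw [this, hχm _ _ (neg_ne_zero.2 hm.1) h1.1, htriv _ hb, mul_one]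

theorem hh_inv (h : Val v) {ψ χ : F → ℂ}
    (hψadd : ∀ x y : F, ψ (x + y) = ψ x * ψ y) (hψ1 : ∀ x : F, Bl v 0 x → ψ x = 1)
    (hχm : ∀ x y : F, x ≠ 0 → y ≠ 0 → χ (x * y) = χ x * χ y)
    {c : ℤ} (hc : 1 ≤ c) (htriv : ∀ x : F, Bl v c x → χ (1 + x) = 1)
    {l N : ℤ} (hN0 : 0 ≤ N) (hN : l + c ≤ N) {a : F} (ha : Bl v 0 a)
    (m t : F) (ht : Bl v N t) : hh v ψ χ l a (m + t) = hh v ψ χ l a m := by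
  unfold hh
  by_cases hm : Sh v l m
  · rw [if_pos hm, if_pos ((sh_add_iff h (by omega) ht).2 hm),
      chi_add h hχm hc htriv hm (ht.mono hN), mul_add, hψadd,
      hψ1 (a * t) ((ha.mul h ht).mono (by omega)), mul_one]
  · rw [if_neg hm, if_neg (fun h' => hm ((sh_add_iff h (by omega) ht).1 h'))]

theorem vanish_mul (h : Val v) {ψ χ : F → ℂ}
    (hψadd : ∀ x y : F, ψ (x + y) = ψ x * ψ y) (hψ1 : ∀ x : F, Bl v 0 x → ψ x = 1)
    (hχm : ∀ x y : F, x ≠ 0 → y ≠ 0 → χ (x * y) = χ x * χ y)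
    {c : ℤ} (hc : 1 ≤ c) (htriv : ∀ x : F, Bl v c x → χ (1 + x) = 1)
    {u : F} (hu : Sh v 0 u) (hu1 : Bl v (c - 1) (u - 1)) (hχu : χ u ≠ 1)
    {l N k : ℤ} (hN0 : 0 ≤ N) (hN : l + c ≤ N) (hk0 : 0 ≤ k) {a : F} (ha : Bl v k a)
    (hk : 1 ≤ k + l + c)
    {R : Finset F} (hR : IsRep v l N R) : ∑ r ∈ R, hh v ψ χ l a r = 0 := by
  have e1 := hR.sum_mul h (hh v ψ χ l a)
    (hh_inv h hψadd hψ1 hχm hc htriv hN0 hN (ha.mono hk0)) u hu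
  have e2 : ∀ m, hh v ψ χ l a (u * m) = (χ u)⁻¹ * hh v ψ χ l a m := by
    intro m
    unfold hh
    by_cases hm : Sh v l m
    · rw [if_pos hm, if_pos ((sh_mul_iff h hu).2 hm), ← mul_neg,
        hχm _ _ hu.1 (neg_ne_zero.2 hm.1), mul_inv]
      have : a * (u * m) = a * m + a * (u - 1) * m := by ring
      rw [this, hψadd, hψ1 (a * (u - 1) * m)
        (((ha.mul h hu1).mul h hm.bl).mono (by omega))]
      ring
    · rw [if_neg hm, if_neg (fun h' => hm ((sh_mul_iff h hu).1 h')), mul_zero]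
  simp only [e2] at e1
  rw [← Finset.mul_sum] at e1
  by_contra hne
  apply hχu
  have := mul_right_cancel₀ hne (e1.trans (one_mul _).symm)
  simpa using this

theorem vanish_add (h : Val v) {ψ χ : F → ℂ}
    (hψadd : ∀ x y : F, ψ (x + y) = ψ x * ψ y) (hψ1 : ∀ x : F, Bl v 0 x → ψ x = 1)
    (hχm : ∀ x y : F, x ≠ 0 → y ≠ 0 → χ (x * y) = χ x * χ y)
    {c : ℤ} (hc : 1 ≤ c) (htriv : ∀ x : F, Bl v c x → χ (1 + x) = 1)
    {t : F} (ht : Bl v (-1) t) (hψt : ψ t ≠ 1)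
    {l : ℤ} (hl : l < -c)
    {R : Finset F} (hR : IsRep v l 0 R) : ∑ r ∈ R, hh v ψ χ l 1 r = 0 := by
  have e1 := hR.sum_shift h (hh v ψ χ l 1)
    (hh_inv h hψadd hψ1 hχm hc htriv le_rfl (by omega) (Or.inr h.one.ge)) t
    (ht.mono (by omega))
  have e2 : ∀ m, hh v ψ χ l 1 (m + t) = ψ t * hh v ψ χ l 1 m := by
    intro m
    unfold hh
    by_cases hm : Sh v l m
    · rw [if_pos hm, if_pos ((sh_add_iff h (by omega) ht).2 hm),
        chi_add h hχm hc htriv hm (ht.mono (by omega)), one_mul, one_mul, hψadd]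
      ring
    · rw [if_neg hm, if_neg (fun h' => hm ((sh_add_iff h (by omega) ht).1 h')), mul_zero]
  simp only [e2] at e1
  rw [← Finset.mul_sum] at e1
  by_contra hne
  apply hψt
  exact mul_right_cancel₀ hne (e1.trans (one_mul _).symm)

theorem gauss_ne (h : Val v) {ψ χ : F → ℂ}
    (hψadd : ∀ x y : F, ψ (x + y) = ψ x * ψ y) (hψ1 : ∀ x : F, Bl v 0 x → ψ x = 1)
    (hχm : ∀ x y : F, x ≠ 0 → y ≠ 0 → χ (x * y) = χ x * χ y)
    (hχ0 : ∀ x : F, x ≠ 0 → χ x ≠ 0)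
    {c : ℤ} (hc : 1 ≤ c) (htriv : ∀ x : F, Bl v c x → χ (1 + x) = 1)
    {u : F} (hu : Sh v 0 u) (hu1 : Bl v (c - 1) (u - 1)) (hχu : χ u ≠ 1)
    {t : F} (ht0 : t ≠ 0) (ht : Bl v (-1) t) (hψt : ψ t ≠ 1)
    {p : F} (hp : Sh v (-c) p)
    {R R' : Finset F} (hR : IsRep v (-c) 0 R) (hR' : IsRep v 0 c R') :
    ∑ r ∈ R, hh v ψ χ (-c) 1 r ≠ 0 := by
  intro hz
  -- all twisted sums vanish
  have hG : ∀ a, Bl v 0 a → ∑ r ∈ R, hh v ψ χ (-c) a r = 0 := by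
    intro a ha
    by_cases ha1 : Bl v 1 a
    · exact vanish_mul h hψadd hψ1 hχm hc htriv hu hu1 hχu le_rfl (by omega)
        zero_le_one ha1 (by omega) hR
    · have hau : Sh v 0 a := sh_iff.2 ⟨ha, ha1⟩
      have e1 := hR.sum_mul h (hh v ψ χ (-c) 1)
        (hh_inv h hψadd hψ1 hχm hc htriv le_rfl (by omega) (Or.inr h.one.ge)) a hau
      have e2 : ∀ m, hh v ψ χ (-c) 1 (a * m) = (χ a)⁻¹ * hh v ψ χ (-c) a m := by
        intro m
        unfold hh
        by_cases hm : Sh v (-c) m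
        · rw [if_pos hm, if_pos ((sh_mul_iff h hau).2 hm), ← mul_neg,
            hχm _ _ hau.1 (neg_ne_zero.2 hm.1), mul_inv, one_mul]
          ring
        · rw [if_neg hm, if_neg (fun h' => hm ((sh_mul_iff h hau).1 h')), mul_zero]
      simp only [e2] at e1
      rw [← Finset.mul_sum, hz] at e1
      exact (mul_eq_zero.1 e1).resolve_left (inv_ne_zero (hχ0 a hau.1))
  -- orthogonality
  have horth : ∀ y, Bl v (-c) y → ¬ Bl v 0 y → ∑ a ∈ R', ψ (a * y) = 0 := by
    intro y hy hy0
    have hyne : y ≠ 0 := fun h' => hy0 (Or.inl h')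
    have hvy : v y < 0 := by
      by_contra h'; exact hy0 (Or.inr (by omega))
    have e1 := hR'.sum_shift h (fun a => ψ (a * y)) (by
      intro m s hs
      show ψ ((m + s) * y) = ψ (m * y)
      rw [add_mul, hψadd, hψ1 (s * y) ((hs.mul h hy).mono (by omega)), mul_one])
      (t / y) (by
        right
        have := ht.resolve_left ht0
        rw [h.div _ _ ht0 hyne]; omega)
    have e2 : ∀ a, ψ ((a + t / y) * y) = ψ t * ψ (a * y) := by
      intro a
      rw [add_mul, div_mul_cancel₀ _ hyne, hψadd, mul_comm]
    simp only [e2] at e1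
    rw [← Finset.mul_sum] at e1
    by_contra hne
    exact hψt (mul_right_cancel₀ hne (e1.trans (one_mul _).symm))
  obtain ⟨m0, hm0, hpm⟩ := hR.ex p hp.bl
  have hsm0 : Sh v (-c) m0 := by
    have := (sh_add_iff h (l := -c) (n := 0) (x := m0) (by omega) hpm).1 (by simpa using hp)
    exact this
  have hsum : ∑ a ∈ R', ψ (-(a * m0)) * ∑ r ∈ R, hh v ψ χ (-c) a r = 0 := by
    apply Finset.sum_eq_zero
    intro a ha
    rw [hG a (hR'.mem a ha), mul_zero]
  have hsum2 : ∑ a ∈ R', ψ (-(a * m0)) * ∑ r ∈ R, hh v ψ χ (-c) a r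
      = (R'.card : ℂ) * (χ (-m0))⁻¹ := by
    simp only [Finset.mul_sum]
    rw [Finset.sum_comm, Finset.sum_eq_single m0]
    · have : ∀ a ∈ R', ψ (-(a * m0)) * hh v ψ χ (-c) a m0 = (χ (-m0))⁻¹ := by
        intro a _
        unfold hh
        rw [if_pos hsm0, mul_left_comm, ← hψadd, neg_add_cancel, hψ1 0 (Or.inl rfl), mul_one]
      rw [Finset.sum_congr rfl this, Finset.sum_const, nsmul_eq_mul]
    · intro r hr hrm
      by_cases hs : Sh v (-c) r
      · have : ∀ a ∈ R', ψ (-(a * m0)) * hh v ψ χ (-c) a r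
            = (χ (-r))⁻¹ * ψ (a * (r - m0)) := by
          intro a _
          unfold hh
          rw [if_pos hs, mul_left_comm, ← hψadd]
          congr 2; ring
        rw [Finset.sum_congr rfl this, ← Finset.mul_sum,
          horth _ (hs.bl.sub h hsm0.bl) (fun h' => hrm (hR.uniq r hr m0 hm0 h')), mul_zero]
      · apply Finset.sum_eq_zero
        intro a _
        unfold hh
        rw [if_neg hs, mul_zero]
    · intro h'; exact absurd hm0 h'
  rw [hsum2] at hsum
  obtain ⟨r0, hr0, _⟩ := hR'.ex 0 (Or.inl rfl)
  have hcard : (R'.card : ℂ) ≠ 0 := by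
    exact_mod_cast (Finset.card_pos.2 ⟨r0, hr0⟩).ne'
  exact mul_ne_zero hcard (inv_ne_zero (hχ0 _ (neg_ne_zero.2 hsm0.1))) hsum

end chars

end Stmt19

open Stmt19

/-- The Whittaker value at `diag(α,1)` of the new vector of the
ramified principal series `π(μ₁⁻¹, μ₂⁻¹)` (`μ₁` unramified, `μ₂` of level `c ≥ 1`):
with the shell sum `S(α) = Σ_{l ≤ v(α)−c} ∫_{v(m)=l} μ₁⁻¹(α/m)μ₂⁻¹(−m)|α|^{1/2}|m|⁻¹ψ(m) dm`
only the shell `l = −c` can contribute; the constant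
`C = q^{−c}μ₁(ϖ)^{−c}∫_{v(m)=−c}μ₂⁻¹(−m)ψ(m) dm` is nonzero, and
`S(α) = C·q^{−v(α)/2}·μ₁(ϖ)^{−v(α)}` for `v(α) ≥ 0`, `S(α) = 0` for `v(α) < 0`. -/
theorem stmt_19
    (F : Type*) [Field F] [MeasurableSpace F]
    (v : F → ℤ) (ϖ : F) (q : ℕ) (hq : 2 ≤ q)
    (hϖ0 : ϖ ≠ 0) (hϖv : v ϖ = 1)
    (hvmul : ∀ x y : F, x ≠ 0 → y ≠ 0 → v (x * y) = v x + v y)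
    (hvadd : ∀ x y : F, x ≠ 0 → y ≠ 0 → x + y ≠ 0 → min (v x) (v y) ≤ v (x + y))
    (μ : Measure F)
    (haar : ∀ a : F, MeasurePreserving (fun x => a + x) μ μ)
    (hball : ∀ n : ℤ, μ {x : F | x = 0 ∨ n ≤ v x} = (q : ENNReal) ^ (-n))
    (hms : ∀ n : ℤ, MeasurableSet {x : F | x ≠ 0 ∧ v x = n})
    (ψ : F → ℂ) (hψmeas : Measurable ψ)
    (hψadd : ∀ x y : F, ψ (x + y) = ψ x * ψ y)
    (hψ1 : ∀ x : F, (x = 0 ∨ 0 ≤ v x) → ψ x = 1)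
    (hψnt : ∃ x : F, x ≠ 0 ∧ -1 ≤ v x ∧ ψ x ≠ 1)
    (μ₁ : F → ℂ) (hμ₁meas : Measurable μ₁)
    (hμ₁m : ∀ x y : F, x ≠ 0 → y ≠ 0 → μ₁ (x * y) = μ₁ x * μ₁ y)
    (hμ₁u : ∀ x : F, x ≠ 0 → v x = 0 → μ₁ x = 1)
    (hμ₁0 : ∀ x : F, x ≠ 0 → μ₁ x ≠ 0)
    (μ₂ : F → ℂ) (hμ₂meas : Measurable μ₂)
    (hμ₂m : ∀ x y : F, x ≠ 0 → y ≠ 0 → μ₂ (x * y) = μ₂ x * μ₂ y)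
    (hμ₂0 : ∀ x : F, x ≠ 0 → μ₂ x ≠ 0)
    (c : ℤ) (hc : 1 ≤ c)
    (hμ₂triv : ∀ x : F, (x = 0 ∨ c ≤ v x) → μ₂ (1 + x) = 1)
    (hμ₂nt1 : 1 < c → ∃ x : F, (x = 0 ∨ c - 1 ≤ v x) ∧ μ₂ (1 + x) ≠ 1)
    (hμ₂nt2 : c = 1 → ∃ u : F, u ≠ 0 ∧ v u = 0 ∧ μ₂ u ≠ 1) :
    ∀ g : F → ℤ → ℂ,
      (g = fun α l => ∫ m, Set.indicator {m : F | m ≠ 0 ∧ v m = l}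
          (fun m => (μ₁ (α / m))⁻¹ * (μ₂ (-m))⁻¹ * (Real.sqrt q : ℂ) ^ (-(v α)) *
            (q : ℂ) ^ v m * ψ m) m ∂μ) →
    ∀ S : F → ℂ,
      (S = fun α => ∑' l : ℤ, if l ≤ v α - c then g α l else 0) →
    ∀ C : ℂ,
      (C = (q : ℂ) ^ (-c) * μ₁ ϖ ^ (-c) *
          ∫ m, Set.indicator {m : F | m ≠ 0 ∧ v m = -c}
            (fun m => (μ₂ (-m))⁻¹ * ψ m) m ∂μ) →
      C ≠ 0 ∧
      (∀ α : F, α ≠ 0 → ∀ l : ℤ, l ≤ v α - c → l ≠ -c → g α l = 0) ∧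
      (∀ α : F, α ≠ 0 → 0 ≤ v α →
        S α = C * (Real.sqrt q : ℂ) ^ (-(v α)) * μ₁ ϖ ^ (-(v α))) ∧
      (∀ α : F, α ≠ 0 → v α < 0 → S α = 0) := by
  intro g hg S hS C hC
  have h : Val v := ⟨hvmul, hvadd⟩
  have hqE0 : (q : ENNReal) ≠ 0 := by
    have : q ≠ 0 := by omega
    exact_mod_cast this
  have hqC0 : (q : ℂ) ≠ 0 := by
    have : q ≠ 0 := by omega
    exact_mod_cast this
  have hb0 : ∀ n : ℤ, μ {x : F | Bl v n x} ≠ 0 := by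
    intro n
    rw [show {x : F | Bl v n x} = {x : F | x = 0 ∨ n ≤ v x} from rfl, hball n]
    exact (ENNReal.zpow_pos hqE0 (ENNReal.natCast_ne_top q) _).ne'
  have hbt : ∀ n : ℤ, μ {x : F | Bl v n x} ≠ ⊤ := by
    intro n
    rw [show {x : F | Bl v n x} = {x : F | x = 0 ∨ n ≤ v x} from rfl, hball n]
    exact (ENNReal.zpow_lt_top hqE0 (ENNReal.natCast_ne_top q) _).ne
  have hψ1' : ∀ x : F, Bl v 0 x → ψ x = 1 := hψ1
  have htriv : ∀ x : F, Bl v c x → μ₂ (1 + x) = 1 := hμ₂triv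
  obtain ⟨t, ht0, htv, hψt⟩ := hψnt
  have htb : Bl v (-1) t := Or.inr htv
  obtain ⟨u, hu, hu1, hχu⟩ : ∃ u : F, Sh v 0 u ∧ Bl v (c - 1) (u - 1) ∧ μ₂ u ≠ 1 := by
    rcases hc.lt_or_eq with hc1 | hc1
    · obtain ⟨x, hx, hx1⟩ := hμ₂nt1 hc1
      have hx' : Bl v (c - 1) x := hx
      exact ⟨1 + x, Sh.add h (l := 0) (n := c - 1) ⟨one_ne_zero, h.one⟩ (by omega) hx',
        by simpa using hx', hx1⟩
    · obtain ⟨u, hu0, huv, hu1⟩ := hμ₂nt2 hc1.symm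
      have hu : Sh v 0 u := ⟨hu0, huv⟩
      refine ⟨u, hu, ?_, hu1⟩
      rw [← hc1]
      exact hu.bl.sub h (Or.inr h.one.ge)
  -- the basic shell integral
  let I : ℤ → ℂ := fun l => ∫ m, hh v ψ μ₂ l 1 m ∂μ
  have hI : ∀ l N : ℤ, 0 ≤ N → l + c ≤ N → ∀ R, IsRep v l N R →
      I l = (μ.real {x : F | Bl v N x} : ℂ) * ∑ r ∈ R, hh v ψ μ₂ l 1 r := by
    intro l N hN0 hN R hR
    refine integral_rep h hms haar l N (by omega) (hbt N) hR _
      (hh_inv h hψadd hψ1' hμ₂m hc htriv hN0 hN (Or.inr h.one.ge)) ?_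
    intro m hm
    unfold hh
    exact if_neg (fun h' => hm h'.bl)
  have hrep : ∀ M N : ℤ, M ≤ N → ∃ R, IsRep v M N R := fun M N hMN =>
    exists_rep h hms haar M N hMN (hb0 N) (hbt M)
  have hIvan : ∀ l : ℤ, l ≠ -c → I l = 0 := by
    intro l hl
    rcases lt_or_gt_of_ne hl with hl | hl
    · obtain ⟨R, hR⟩ := hrep l 0 (by omega)
      rw [hI l 0 le_rfl (by omega) R hR,
        vanish_add h hψadd hψ1' hμ₂m hc htriv htb hψt hl hR, mul_zero]
    · obtain ⟨R, hR⟩ := hrep l (l + c) (by omega)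
      rw [hI l (l + c) (by omega) le_rfl R hR,
        vanish_mul h hψadd hψ1' hμ₂m hc htriv hu hu1 hχu (by omega) le_rfl le_rfl
          (Or.inr h.one.ge) (by omega) hR, mul_zero]
  have hIne : I (-c) ≠ 0 := by
    obtain ⟨R, hR⟩ := hrep (-c) 0 (by omega)
    obtain ⟨R', hR'⟩ := hrep 0 c (by omega)
    rw [hI (-c) 0 le_rfl (by omega) R hR]
    refine mul_ne_zero ?_ (gauss_ne h hψadd hψ1' hμ₂m hμ₂0 hc htriv hu hu1 hχu ht0 htb hψt
      (p := ϖ ^ (-c)) ⟨zpow_ne_zero _ hϖ0, by rw [h.zpow _ hϖ0, hϖv, mul_one]⟩ hR hR')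
    rw [measureReal_def]
    exact_mod_cast (ENNReal.toReal_ne_zero.2 ⟨hb0 0, hbt 0⟩)
  have hCI : C = (q : ℂ) ^ (-c) * μ₁ ϖ ^ (-c) * I (-c) := by
    rw [hC]
    congr 1
    refine integral_congr_ae (Filter.Eventually.of_forall fun m => ?_)
    classical
    simp only [Set.indicator_apply, hh, Sh, Set.mem_ofPred_eq, one_mul]
  have hμ₁1 : μ₁ 1 = 1 := hμ₁u 1 one_ne_zero h.one
  have hμ₁zpow : ∀ n : ℤ, μ₁ (ϖ ^ n) = μ₁ ϖ ^ n := by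
    have hn : ∀ n : ℕ, μ₁ (ϖ ^ n) = μ₁ ϖ ^ n := by
      intro n
      induction n with
      | zero => simp [hμ₁1]
      | succ n ih => rw [pow_succ, hμ₁m _ _ (pow_ne_zero _ hϖ0) hϖ0, ih, pow_succ]
    intro n
    obtain ⟨k, rfl | rfl⟩ := n.eq_nat_or_neg
    · simp [hn]
    · rw [zpow_neg, zpow_neg, zpow_natCast, zpow_natCast]
      have := hμ₁m (ϖ ^ k) (ϖ ^ k)⁻¹ (pow_ne_zero _ hϖ0) (inv_ne_zero (pow_ne_zero _ hϖ0))
      rw [mul_inv_cancel₀ (pow_ne_zero _ hϖ0), hμ₁1, hn] at this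
      exact eq_inv_of_mul_eq_one_right this.symm
  have hμ₁val : ∀ x : F, x ≠ 0 → μ₁ x = μ₁ ϖ ^ (v x) := by
    intro x hx
    have hz : ϖ ^ (v x) ≠ 0 := zpow_ne_zero _ hϖ0
    have := hμ₁m (x / ϖ ^ (v x)) (ϖ ^ (v x)) (div_ne_zero hx hz) hz
    rw [div_mul_cancel₀ _ hz, hμ₁zpow, hμ₁u _ (div_ne_zero hx hz), one_mul] at this
    · exact this
    · rw [h.div _ _ hx hz, h.zpow _ hϖ0, hϖv]; ring
  have hgI : ∀ α : F, α ≠ 0 → ∀ l : ℤ, g α l =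
      (μ₁ ϖ ^ (v α - l))⁻¹ * (Real.sqrt q : ℂ) ^ (-(v α)) * (q : ℂ) ^ l * I l := by
    intro α hα l
    rw [hg]
    show _ = _ * ∫ m, hh v ψ μ₂ l 1 m ∂μ
    rw [← integral_const_mul]
    refine integral_congr_ae (Filter.Eventually.of_forall fun m => ?_)
    classical
    simp only [Set.indicator_apply, hh, Set.mem_ofPred_eq, one_mul]
    by_cases hm : Sh v l m
    · rw [if_pos hm, if_pos (show m ≠ 0 ∧ v m = l from hm), hμ₁val _ (div_ne_zero hα hm.1),
        h.div _ _ hα hm.1, hm.2]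
      ring
    · rw [if_neg hm, if_neg (show ¬ (m ≠ 0 ∧ v m = l) from hm), mul_zero]
  have hgvan : ∀ α : F, α ≠ 0 → ∀ l : ℤ, l ≠ -c → g α l = 0 := by
    intro α hα l hl
    rw [hgI α hα, hIvan l hl, mul_zero]
  have hSsum : ∀ α : F, α ≠ 0 → S α = if -c ≤ v α - c then g α (-c) else 0 := by
    intro α hα
    rw [hS]
    refine tsum_eq_single (-c) ?_
    intro l hl
    rw [hgvan α hα l hl, ite_self]
  have hϖne : μ₁ ϖ ≠ 0 := hμ₁0 ϖ hϖ0
  refine ⟨?_, ?_, ?_, ?_⟩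
  · rw [hCI]
    exact mul_ne_zero (mul_ne_zero (zpow_ne_zero _ hqC0) (zpow_ne_zero _ hϖne)) hIne
  · intro α hα l _ hl
    exact hgvan α hα l hl
  · intro α hα hv
    rw [hSsum α hα, if_pos (by omega), hgI α hα, hCI, ← zpow_neg,
      show -(v α - -c) = -c + -(v α) by ring, zpow_add₀ hϖne]
    ring
  · intro α hα hv
    rw [hSsum α hα, if_neg (by omega)]
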